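/- arXiv:1702.01136 — 3 statements merged into one kernel-verified Lean document; each statement's English description precedes it below -/
import Mathlib

section
/- For every integer n ≥ 2 there exists a node embedding ρ of the grid graph Grid_n into the half-grid T_{4n−3} such that every boundary vertex of Grid_n (a vertex (i,j) with i ∈ {1,n} or j ∈ {1,n}) is mapped to a diagonal vertex of T_{4n−3} (a vertex of the form (m,m)). -/
/-- The ℓ₁-distance between two points of `ℕ × ℕ`. -/
def l1dist (p q : ℕ × ℕ) : ℕ :=
  ((p.1 - q.1) + (q.1 - p.1)) + ((p.2 - q.2) + (q.2 - p.2))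

/-- The vertex set of the grid graph `Grid_n`: `{1,…,n} × {1,…,n}`. -/
def gridVerts (n : ℕ) : Set (ℕ × ℕ) :=
  {p | 1 ≤ p.1 ∧ p.1 ≤ n ∧ 1 ≤ p.2 ∧ p.2 ≤ n}

/-- Adjacency in the grid graph `Grid_n`: two vertices are adjacent iff their
ℓ₁-distance is 1. -/
def gridAdj (n : ℕ) (p q : ℕ × ℕ) : Prop :=
  p ∈ gridVerts n ∧ q ∈ gridVerts n ∧ l1dist p q = 1

/-- The vertex set of the half-grid `T_ℓ`: `{(i,j) : 1 ≤ i ≤ j ≤ ℓ}`. -/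
def hgVerts (l : ℕ) : Set (ℕ × ℕ) :=
  {p | 1 ≤ p.1 ∧ p.1 ≤ p.2 ∧ p.2 ≤ l}

/-- Adjacency in the half-grid `T_ℓ`: two vertices are adjacent iff their ℓ₁-distance
is 1, together with the diagonal edges `{(i,i),(i+1,i+1)}`. -/
def hgAdj (l : ℕ) (p q : ℕ × ℕ) : Prop :=
  p ∈ hgVerts l ∧ q ∈ hgVerts l ∧
    (l1dist p q = 1 ∨
      (p.1 = p.2 ∧ q.1 = q.2 ∧ (q.1 = p.1 + 1 ∨ p.1 = q.1 + 1)))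

/-- `p` is a path from `s` to `t` in the graph with adjacency relation `A`, recorded
as the list of its vertices. -/
def IsUPath {V : Type*} (A : V → V → Prop) (s t : V) (p : List V) : Prop :=
  p.Chain' A ∧ p.head? = some s ∧ p.getLast? = some t

/-- The embedding on vertices. -/
def rhoE (n : ℕ) (p : ℕ × ℕ) : ℕ × ℕ :=
  if p.2 = 1 then (p.1, p.1)
  else if p.1 = n then (n + p.2 - 1, n + p.2 - 1)
  else if p.2 = n then (3 * n - 1 - p.1, 3 * n - 1 - p.1)
  else if p.1 = 1 then (4 * n - 2 - p.2, 4 * n - 2 - p.2)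
  else (n + p.2 - 1, 3 * n - 1 - p.1)

/-- Interior vertices of the path of the edge from `(a,b)` to `(c,d)`. -/
def SpE (n a b c d i j : ℕ) : Prop :=
  -- closing edge
  (a = 1 ∧ b = 1 ∧ c = 1 ∧ d = 2 ∧
    ((i = 1 ∧ 2 ≤ j ∧ j ≤ 4 * n - 3) ∨ (j = 4 * n - 3 ∧ 1 ≤ i ∧ i ≤ 4 * n - 3))) ∨
  -- left
  (a = 1 ∧ c = 2 ∧ b = d ∧ 2 ≤ b ∧ b + 1 ≤ n ∧
    ((i = n + b - 1 ∧ 3 * n - 3 < j ∧ j ≤ 4 * n - 2 - b) ∨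
     (j = 4 * n - 2 - b ∧ n + b - 1 ≤ i ∧ i < 4 * n - 2 - b))) ∨
  -- right
  (a + 1 = n ∧ c = n ∧ b = d ∧ 2 ≤ b ∧ b + 1 ≤ n ∧
    (i = n + b - 1 ∧ n + b - 1 < j ∧ j < 2 * n)) ∨
  -- bottom
  (b = 1 ∧ d = 2 ∧ a = c ∧ 2 ≤ a ∧ a + 1 ≤ n ∧
    ((i = a ∧ a < j ∧ j ≤ 3 * n - 1 - a) ∨
     (j = 3 * n - 1 - a ∧ a ≤ i ∧ i < n + 1))) ∨
  -- top
  (b + 1 = n ∧ d = n ∧ a = c ∧ 2 ≤ a ∧ a + 1 ≤ n ∧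
    (j = 3 * n - 1 - a ∧ 2 * n - 2 < i ∧ i < 3 * n - 1 - a))

lemma SpE_unique {n a b c d a' b' c' d' i j : ℕ} (hn : 2 ≤ n)
    (h : SpE n a b c d i j) (h' : SpE n a' b' c' d' i j) :
    a = a' ∧ b = b' ∧ c = c' ∧ d = d' := by
  unfold SpE at h h'
  rcases h with h | h | h | h | h <;> rcases h' with h' | h' | h' | h' | h' <;> omega

lemma SpE_ne_rho {n a b c d i j : ℕ} (hn : 2 ≤ n) (h : SpE n a b c d i j)
    (p : ℕ × ℕ) (hp : p ∈ gridVerts n) : (i, j) ≠ rhoE n p := by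
  obtain ⟨x, y⟩ := p
  simp only [gridVerts, Set.mem_ofPred_eq] at hp
  unfold SpE at h
  intro he
  unfold rhoE at he
  split_ifs at he <;> simp only [Prod.mk.injEq] at he <;>
    rcases h with h | h | h | h | h <;> omega

/-- All vertices of the path of the edge `{u,v}`. -/
def SE (n : ℕ) (u v w : ℕ × ℕ) : Prop :=
  w = rhoE n u ∨ w = rhoE n v ∨ SpE n u.1 u.2 v.1 v.2 w.1 w.2 ∨ SpE n v.1 v.2 u.1 u.2 w.1 w.2

/-- Connection inside a vertex set. -/
def ConnE (l : ℕ) (S : ℕ × ℕ → Prop) : ℕ × ℕ → ℕ × ℕ → Prop :=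
  Relation.ReflTransGen (fun p q => hgAdj l p q ∧ S p ∧ S q)

lemma hgAdj_symm' {l : ℕ} {p q : ℕ × ℕ} (h : hgAdj l p q) : hgAdj l q p := by
  unfold hgAdj l1dist at *
  refine ⟨h.2.1, h.1, ?_⟩
  have := h.2.2
  omega

lemma hgAdj_diag {l a b : ℕ} (ha : 1 ≤ a) (hb : 1 ≤ b) (ha' : a ≤ l) (hb' : b ≤ l)
    (h : b = a + 1 ∨ a = b + 1) : hgAdj l (a, a) (b, b) :=
  ⟨⟨ha, le_rfl, ha'⟩, ⟨hb, le_rfl, hb'⟩, Or.inr ⟨rfl, rfl, h⟩⟩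

lemma ConnE.symm {l : ℕ} {S : ℕ × ℕ → Prop} {p q : ℕ × ℕ} (h : ConnE l S p q) :
    ConnE l S q p :=
  by
  have : Std.Symm (fun p q => hgAdj l p q ∧ S p ∧ S q) :=
    ⟨fun _ _ h => ⟨hgAdj_symm' h.1, h.2.2, h.2.1⟩⟩
  exact (Relation.ReflTransGen.stdSymm (r := fun p q => hgAdj l p q ∧ S p ∧ S q)).symm _ _ h

lemma ConnE.row {l : ℕ} {S : ℕ × ℕ → Prop} (i a b : ℕ) (hab : a ≤ b)
    (hi : 1 ≤ i) (hia : i ≤ a) (hb : b ≤ l)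
    (h : ∀ j, a ≤ j → j ≤ b → S (i, j)) : ConnE l S (i, a) (i, b) := by
  induction b, hab using Nat.le_induction with
  | base => exact Relation.ReflTransGen.refl
  | succ b hab ih =>
    refine Relation.ReflTransGen.tail (ih (by omega) (fun j h1 h2 => h j h1 (by omega))) ?_
    refine ⟨?_, h _ hab (by omega), h _ (by omega) le_rfl⟩
    simp only [hgAdj, hgVerts, l1dist, Set.mem_ofPred_eq]
    omega

lemma ConnE.col {l : ℕ} {S : ℕ × ℕ → Prop} (j a b : ℕ) (hab : a ≤ b)
    (ha : 1 ≤ a) (hb : b ≤ j) (hj : j ≤ l)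
    (h : ∀ i, a ≤ i → i ≤ b → S (i, j)) : ConnE l S (a, j) (b, j) := by
  induction b, hab using Nat.le_induction with
  | base => exact Relation.ReflTransGen.refl
  | succ b hab ih =>
    refine Relation.ReflTransGen.tail (ih (by omega) (fun i h1 h2 => h i h1 (by omega))) ?_
    refine ⟨?_, h _ hab (by omega), h _ (by omega) le_rfl⟩
    simp only [hgAdj, hgVerts, l1dist, Set.mem_ofPred_eq]
    omega

lemma ConnE.toPath {l : ℕ} {S : ℕ × ℕ → Prop} {p q : ℕ × ℕ} (h : ConnE l S p q) (hq : S q) :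
    ∃ L, IsUPath (hgAdj l) p q L ∧ ∀ w ∈ L, S w := by
  induction h using Relation.ReflTransGen.head_induction_on with
  | refl => exact ⟨[q], ⟨List.IsChain.singleton _, rfl, rfl⟩, by simpa using hq⟩
  | head h' _ ih =>
    rename_i a0 c _
    obtain ⟨L, ⟨h1, h2, h3⟩, h4⟩ := ih
    rcases L with _ | ⟨x, L⟩
    · simp at h2
    · simp only [List.head?_cons, Option.some.injEq] at h2
      rw [← h2] at h'
      refine ⟨a0 :: x :: L, ⟨List.IsChain.cons_cons h'.1 h1, rfl, by simpa using h3⟩, ?_⟩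
      intro w hw
      rcases List.mem_cons.1 hw with rfl | hw
      · exact h'.2.1
      · exact h4 w hw

lemma SE_symm {n : ℕ} {u v w : ℕ × ℕ} (h : SE n u v w) : SE n v u w := by
  unfold SE at *; tauto

lemma conn_step {n : ℕ} {u v : ℕ × ℕ} (h : hgAdj (4 * n - 3) (rhoE n u) (rhoE n v)) :
    ConnE (4 * n - 3) (SE n u v) (rhoE n u) (rhoE n v) :=
  Relation.ReflTransGen.single ⟨h, Or.inl rfl, Or.inr (Or.inl rfl)⟩

lemma rho_bot (n x : ℕ) : rhoE n (x, 1) = (x, x) := by simp [rhoE]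

lemma rho_right (n y : ℕ) (hn : 2 ≤ n) (hy : 1 ≤ y) :
    rhoE n (n, y) = (n + y - 1, n + y - 1) := by
  unfold rhoE; split_ifs <;> simp_all

lemma rho_top (n x : ℕ) (hn : 2 ≤ n) (hx : x ≤ n) :
    rhoE n (x, n) = (3 * n - 1 - x, 3 * n - 1 - x) := by
  unfold rhoE; split_ifs <;> simp_all <;> omega

lemma rho_left (n y : ℕ) (hn : 2 ≤ n) (hy : 2 ≤ y) (hy' : y ≤ n) :
    rhoE n (1, y) = (4 * n - 2 - y, 4 * n - 2 - y) := by
  unfold rhoE; split_ifs <;> simp_all <;> omega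

lemma rho_int (n x y : ℕ) (hx : 2 ≤ x) (hx' : x + 1 ≤ n) (hy : 2 ≤ y) (hy' : y + 1 ≤ n) :
    rhoE n (x, y) = (n + y - 1, 3 * n - 1 - x) := by
  unfold rhoE; split_ifs <;> simp_all <;> omega

lemma conn_H (n x y : ℕ) (hn : 2 ≤ n) (hx : 1 ≤ x) (hx' : x + 1 ≤ n) (hy : 1 ≤ y) (hy' : y ≤ n) :
    ConnE (4 * n - 3) (SE n (x, y) (x + 1, y)) (rhoE n (x, y)) (rhoE n (x + 1, y)) := by
  by_cases hb : y = 1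
  · subst hb
    apply conn_step
    rw [rho_bot, rho_bot]
    apply hgAdj_diag <;> omega
  by_cases ht : y = n
  · subst ht
    apply conn_step
    rw [rho_top _ _ hn (by omega), rho_top _ _ hn hx']
    apply hgAdj_diag <;> omega
  by_cases hl : x = 1
  · subst hl
    have e1 := rho_left n y hn (by omega) (by omega)
    have e2 := rho_int n 2 y (by omega) (by omega) (by omega) (by omega)
    have c1 : ConnE (4 * n - 3) (SE n (1, y) (2, y))
        (n + y - 1, 3 * n - 1 - 2) (n + y - 1, 4 * n - 2 - y) := by
      apply ConnE.row <;> try omega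
      intro j h1 h2
      by_cases hce2 : j = 3 * n - 1 - 2
      · refine Or.inr (Or.inl ?_)
        rw [e2, Prod.mk.injEq]
        omega
      refine Or.inr (Or.inr (Or.inl (Or.inr (Or.inl ?_))))
      dsimp only
      omega
    have c2 : ConnE (4 * n - 3) (SE n (1, y) (2, y))
        (n + y - 1, 4 * n - 2 - y) (4 * n - 2 - y, 4 * n - 2 - y) := by
      apply ConnE.col <;> try omega
      intro j h1 h2
      by_cases hce1 : j = 4 * n - 2 - y
      · refine Or.inl ?_
        rw [e1, Prod.mk.injEq]
        omega
      refine Or.inr (Or.inr (Or.inl (Or.inr (Or.inl ?_))))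
      dsimp only
      omega
    rw [show (1 + 1 : ℕ) = 2 from rfl, e1, e2]
    exact ConnE.symm (Relation.ReflTransGen.trans c1 c2)
  by_cases hr : x + 1 = n
  · have e1 := rho_int n x y (by omega) (by omega) (by omega) (by omega)
    have e2 := rho_right n y hn (by omega)
    have e2 : rhoE n (x + 1, y) = (n + y - 1, n + y - 1) := by rwa [hr]
    rw [e1, e2]
    have c1 : ConnE (4 * n - 3) (SE n (x, y) (x + 1, y))
        (n + y - 1, n + y - 1) (n + y - 1, 3 * n - 1 - x) := by
      apply ConnE.row <;> try omega
      intro j h1 h2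
      by_cases hce2 : j = n + y - 1
      · refine Or.inr (Or.inl ?_)
        rw [e2, Prod.mk.injEq]
        omega
      by_cases hce1 : j = 3 * n - 1 - x
      · refine Or.inl ?_
        rw [e1, Prod.mk.injEq]
        omega
      refine Or.inr (Or.inr (Or.inl (Or.inr (Or.inr (Or.inl ?_)))))
      dsimp only
      omega
    exact c1.symm
  · apply conn_step
    rw [rho_int, rho_int] <;> try omega
    simp only [hgAdj, hgVerts, l1dist, Set.mem_ofPred_eq]
    omega

lemma conn_V (n x y : ℕ) (hn : 2 ≤ n) (hx : 1 ≤ x) (hx' : x ≤ n) (hy : 1 ≤ y) (hy' : y + 1 ≤ n) :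
    ConnE (4 * n - 3) (SE n (x, y) (x, y + 1)) (rhoE n (x, y)) (rhoE n (x, y + 1)) := by
  by_cases hr : x = n
  · subst hr
    apply conn_step
    rw [rho_right, rho_right] <;> try omega
    apply hgAdj_diag <;> omega
  by_cases hl : x = 1
  · subst hl
    by_cases hb : y = 1
    · subst hb
      have e1 := rho_bot n 1
      have e2 := rho_left n 2 hn (by omega) (by omega)
      have key : ∀ i j : ℕ, ((i = 1 ∧ 1 ≤ j ∧ j ≤ 4 * n - 3) ∨
          (j = 4 * n - 3 ∧ 1 ≤ i ∧ i ≤ 4 * n - 3)) → SE n (1, 1) (1, 2) (i, j) := by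
        intro i j h
        by_cases hce1 : i = 1 ∧ j = 1
        · refine Or.inl ?_
          rw [e1, Prod.mk.injEq]
          omega
        refine Or.inr (Or.inr (Or.inl (Or.inl ?_)))
        dsimp only
        omega
      rw [show (1 + 1 : ℕ) = 2 from rfl, e1, e2]
      have c1 : ConnE (4 * n - 3) (SE n (1, 1) (1, 2)) (1, 1) (1, 4 * n - 3) := by
        apply ConnE.row <;> try omega
        intro j h1 h2
        exact key _ _ (by omega)
      have c2 : ConnE (4 * n - 3) (SE n (1, 1) (1, 2)) (1, 4 * n - 3) (4 * n - 3, 4 * n - 3) := by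
        apply ConnE.col <;> try omega
        intro j h1 h2
        exact key _ _ (by omega)
      refine Relation.ReflTransGen.tail (Relation.ReflTransGen.trans c1 c2) ⟨?_, key _ _ (by omega), ?_⟩
      · apply hgAdj_diag <;> omega
      · exact Or.inr (Or.inl e2.symm)
    · apply conn_step
      rw [rho_left, rho_left] <;> try omega
      apply hgAdj_diag <;> omega
  by_cases hb : y = 1
  · subst hb
    have e1 := rho_bot n x
    have e2 := rho_int n x 2 (by omega) (by omega) (by omega) (by omega)
    rw [show (1 + 1 : ℕ) = 2 from rfl, e1, e2]
    have c1 : ConnE (4 * n - 3) (SE n (x, 1) (x, 2)) (x, x) (x, 3 * n - 1 - x) := by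
      apply ConnE.row <;> try omega
      intro j h1 h2
      by_cases hce1 : j = x
      · refine Or.inl ?_
        rw [e1, Prod.mk.injEq]
        omega
      refine Or.inr (Or.inr (Or.inl (Or.inr (Or.inr (Or.inr (Or.inl ?_))))))
      dsimp only
      omega
    have c2 : ConnE (4 * n - 3) (SE n (x, 1) (x, 2))
        (x, 3 * n - 1 - x) (n + 2 - 1, 3 * n - 1 - x) := by
      apply ConnE.col <;> try omega
      intro j h1 h2
      by_cases hce2 : j = n + 2 - 1
      · refine Or.inr (Or.inl ?_)
        rw [e2, Prod.mk.injEq]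
        omega
      refine Or.inr (Or.inr (Or.inl (Or.inr (Or.inr (Or.inr (Or.inl ?_))))))
      dsimp only
      omega
    exact Relation.ReflTransGen.trans c1 c2
  by_cases ht : y + 1 = n
  · have e1 := rho_int n x y (by omega) (by omega) (by omega) (by omega)
    have e2 : rhoE n (x, y + 1) = (3 * n - 1 - x, 3 * n - 1 - x) := by
      have := rho_top n x hn (by omega)
      rwa [show (x, y + 1) = (x, n) by rw [ht]]
    rw [e1, e2]
    apply ConnE.col <;> try omega
    intro j h1 h2
    by_cases hce1 : j = n + y - 1
    · refine Or.inl ?_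
      rw [e1, Prod.mk.injEq]
      omega
    by_cases hce2 : j = 3 * n - 1 - x
    · refine Or.inr (Or.inl ?_)
      rw [e2, Prod.mk.injEq]
      omega
    refine Or.inr (Or.inr (Or.inl (Or.inr (Or.inr (Or.inr (Or.inr ?_))))))
    dsimp only
    omega
  · apply conn_step
    rw [rho_int, rho_int] <;> try omega
    simp only [hgAdj, hgVerts, l1dist, Set.mem_ofPred_eq]
    omega

lemma SE_swap (n : ℕ) (u v : ℕ × ℕ) : SE n u v = SE n v u :=
  funext fun _ => propext ⟨SE_symm, SE_symm⟩

lemma conn_all (n : ℕ) (hn : 2 ≤ n) (u v : ℕ × ℕ) (h : gridAdj n u v) :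
    ConnE (4 * n - 3) (SE n u v) (rhoE n u) (rhoE n v) := by
  obtain ⟨a, b⟩ := u
  obtain ⟨c, d⟩ := v
  simp only [gridAdj, gridVerts, l1dist, Set.mem_ofPred_eq] at h
  have : (c = a + 1 ∧ d = b) ∨ (a = c + 1 ∧ b = d) ∨ (c = a ∧ d = b + 1) ∨ (a = c ∧ b = d + 1) := by
    omega
  rcases this with ⟨rfl, rfl⟩ | ⟨rfl, rfl⟩ | ⟨rfl, rfl⟩ | ⟨rfl, rfl⟩
  · exact conn_H n _ _ hn (by omega) (by omega) (by omega) (by omega)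
  · rw [SE_swap]
    exact (conn_H n _ _ hn (by omega) (by omega) (by omega) (by omega)).symm
  · exact conn_V n _ _ hn (by omega) (by omega) (by omega) (by omega)
  · rw [SE_swap]
    exact (conn_V n _ _ hn (by omega) (by omega) (by omega) (by omega)).symm

lemma SE_cases {n : ℕ} {u v w : ℕ × ℕ} (h : SE n u v w) :
    (w = rhoE n u ∨ w = rhoE n v) ∨
      ∃ a b : ℕ × ℕ, SpE n a.1 a.2 b.1 b.2 w.1 w.2 ∧ ({u, v} : Set (ℕ × ℕ)) = {a, b} := by
  rcases h with h | h | h | h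
  · exact Or.inl (Or.inl h)
  · exact Or.inl (Or.inr h)
  · exact Or.inr ⟨u, v, h, rfl⟩
  · exact Or.inr ⟨v, u, h, Set.pair_comm _ _⟩

/-- For every `n ≥ 2` there is a node embedding of the grid `Grid_n` into the
half-grid `T_{4n−3}`: an injective map `ρ` on the vertices together with, for every
edge `{u,v}` of `Grid_n`, a path in `T_{4n−3}` from `ρ u` to `ρ v`, such that the
paths of two distinct edges share no vertices other than possibly common endpoints;
moreover every boundary vertex of `Grid_n` is mapped to a diagonal vertex `(m,m)` of
`T_{4n−3}`. -/
theorem grid_embeds_into_half_grid (n : ℕ) (hn : 2 ≤ n) :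
    ∃ (ρ : ℕ × ℕ → ℕ × ℕ) (path : ℕ × ℕ → ℕ × ℕ → List (ℕ × ℕ)),
      Set.InjOn ρ (gridVerts n) ∧
      (∀ p ∈ gridVerts n, ρ p ∈ hgVerts (4 * n - 3)) ∧
      (∀ u v, gridAdj n u v → IsUPath (hgAdj (4 * n - 3)) (ρ u) (ρ v) (path u v)) ∧
      (∀ u v u' v', gridAdj n u v → gridAdj n u' v' →
        ({u, v} : Set (ℕ × ℕ)) ≠ {u', v'} →
        ∀ w, w ∈ path u v → w ∈ path u' v' →
          ((w = ρ u ∨ w = ρ v) ∧ (w = ρ u' ∨ w = ρ v'))) ∧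
      (∀ p ∈ gridVerts n, (p.1 = 1 ∨ p.1 = n ∨ p.2 = 1 ∨ p.2 = n) →
        ∃ m : ℕ, ρ p = (m, m)) := by
  classical
  have hex : ∀ u v, ∃ L, gridAdj n u v →
      IsUPath (hgAdj (4 * n - 3)) (rhoE n u) (rhoE n v) L ∧ ∀ w ∈ L, SE n u v w := by
    intro u v
    by_cases h : gridAdj n u v
    · obtain ⟨L, hL⟩ := (conn_all n hn u v h).toPath (Or.inr (Or.inl rfl))
      exact ⟨L, fun _ => hL⟩
    · exact ⟨[], fun h' => absurd h' h⟩
  choose path hpath using hex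
  refine ⟨rhoE n, path, ?_, ?_, fun u v h => (hpath u v h).1, ?_, ?_⟩
  · rintro ⟨a, b⟩ hp ⟨c, d⟩ hq he
    simp only [gridVerts, Set.mem_ofPred_eq] at hp hq
    unfold rhoE at he
    simp only [Prod.mk.injEq]
    split_ifs at he <;> simp only [Prod.mk.injEq] at he <;> omega
  · rintro ⟨a, b⟩ hp
    simp only [gridVerts, Set.mem_ofPred_eq] at hp
    unfold rhoE
    split_ifs <;> simp only [hgVerts, Set.mem_ofPred_eq] <;> omega
  · intro u v u' v' h h' hne w hw hw'
    have k : ∀ {a b p : ℕ × ℕ}, SpE n a.1 a.2 b.1 b.2 w.1 w.2 → p ∈ gridVerts n →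
        w ≠ rhoE n p := fun hs hp => SpE_ne_rho hn hs _ hp
    rcases SE_cases ((hpath u v h).2 w hw) with h1 | ⟨a, b, h1, e1⟩ <;>
    rcases SE_cases ((hpath u' v' h').2 w hw') with h2 | ⟨a', b', h2, e2⟩
    · exact ⟨h1, h2⟩
    · rcases h1 with h1 | h1
      · exact absurd h1 (k h2 h.1)
      · exact absurd h1 (k h2 h.2.1)
    · rcases h2 with h2 | h2
      · exact absurd h2 (k h1 h'.1)
      · exact absurd h2 (k h1 h'.2.1)
    · obtain ⟨q1, q2, q3, q4⟩ := SpE_unique hn h1 h2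
      exact absurd (by rw [e1, e2, Prod.ext q1 q2, Prod.ext q3 q4]) hne
  · rintro ⟨a, b⟩ hp hb
    unfold rhoE
    simp only at hb ⊢
    split_ifs
    all_goals first | exact ⟨_, rfl⟩ | (exfalso; omega)
end

section
/- Let t ≥ 3, let 𝒮' = {e₁,…,e_ℓ} be distinct 3-element subsets of {1,…,k} pairwise intersecting in at most one element whose detouring graph contains no detouring cycle of length at most t, with distinguished elements a_i ∈ e_i, and let G_R (for R ⊆ {1,…,ℓ}) be the associated graphs. Then for every R ⊆ {1,…,ℓ}, every i ∉ R, and every x' ∈ e_i ∖ {a_i}, the distance in G_R from a_i to x' is at least 2t. -/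
/-- The unweighted shortest-path distance (number of edges) between `s` and `t` in
the graph with adjacency relation `A`, valued in `ℕ∞` (so `⊤` if `t` is not reachable
from `s`). -/
noncomputable def graphEDist {V : Type*} (A : V → V → Prop) (s t : V) : ℕ∞ :=
  sInf {n : ℕ∞ | ∃ p : List V, p.Chain' A ∧ p.head? = some s ∧
    p.getLast? = some t ∧ n = ((p.length - 1 : ℕ) : ℕ∞)}

/-- The detouring graph of the family `e` of 3-subsets contains a detouring cycle of
length at most `t`: a cyclic sequence of `m` distinct vertices (`3 ≤ m ≤ t`),
consecutive ones adjacent (i.e. sharing exactly one element), such that no two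
consecutive edges of the cycle carry the same label (the label of an edge being the
unique common element of its two endpoints). -/
def HasDetourCycle (L : ℕ) (e : Fin L → Finset ℕ) (t : ℕ) : Prop :=
  ∃ m : ℕ, 3 ≤ m ∧ m ≤ t ∧ ∃ c : ZMod m → Fin L,
    Function.Injective c ∧
    (∀ i : ZMod m, (e (c i) ∩ e (c (i + 1))).card = 1) ∧
    (∀ i : ZMod m, e (c i) ∩ e (c (i + 1)) ≠ e (c (i + 1)) ∩ e (c (i + 2)))

/-- The adjacency relation of the graph `G_R`: its vertices are the terminals
`1,…,k` (as `Sum.inl x`) together with one non-terminal `v_i` (as `Sum.inr i`) for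
each 3-subset `e i`; the non-terminal `v_i` is adjacent to every element of `e i` if
`i ∈ R`, and to every element of `e i` except the distinguished element `a i` if
`i ∉ R`.  All edges have length 1. -/
def GRAdj (L : ℕ) (e : Fin L → Finset ℕ) (a : Fin L → ℕ) (R : Finset (Fin L)) :
    (ℕ ⊕ Fin L) → (ℕ ⊕ Fin L) → Prop := fun p q =>
  (∃ x i, p = Sum.inl x ∧ q = Sum.inr i ∧ x ∈ e i ∧ (i ∈ R ∨ x ≠ a i)) ∨
  (∃ x i, p = Sum.inr i ∧ q = Sum.inl x ∧ x ∈ e i ∧ (i ∈ R ∨ x ≠ a i))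

/-- An alternating walk of `n` double steps given by terminals `x` and triples `j`. -/
def IsAltWalk (L : ℕ) (e : Fin L → Finset ℕ) (a : Fin L → ℕ) (R : Finset (Fin L))
    (n : ℕ) (x : ℕ → ℕ) (j : ℕ → Fin L) : Prop :=
  ∀ s, s < n → (x s ∈ e (j s) ∧ (j s ∈ R ∨ x s ≠ a (j s))) ∧
    (x (s + 1) ∈ e (j s) ∧ (j s ∈ R ∨ x (s + 1) ≠ a (j s)))

theorem exists_altWalk (L : ℕ) (e : Fin L → Finset ℕ) (a : Fin L → ℕ) (R : Finset (Fin L))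
    (i0 : Fin L) (y : ℕ) : ∀ (m : ℕ) (p : List (ℕ ⊕ Fin L)) (u : ℕ), p.length ≤ m →
    List.IsChain (GRAdj L e a R) p → p.head? = some (Sum.inl u) →
    p.getLast? = some (Sum.inl y) →
    ∃ n x j, p.length = 2 * n + 1 ∧ IsAltWalk L e a R n x j ∧ x 0 = u ∧ x n = y := by
  intro m
  induction m with
  | zero =>
    intro p u hl hc hh
    have : p = [] := by simpa using hl
    simp [this] at hh
  | succ m ih =>
    intro p u hl hc hh hy
    match p, hl, hc, hh, hy with
    | [], _, _, hh, _ => simp at hh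
    | [v], _, _, hh, hy =>
      refine ⟨0, fun _ => u, fun _ => i0, by simp, ?_, rfl, ?_⟩
      · intro s hs; omega
      · simp at hh hy
        rw [hh] at hy
        simpa using hy
    | [v, w], _, hc, hh, hy =>
      simp [GRAdj] at hh hy hc
      subst hh hy
      simp at hc
    | v :: w :: z :: l, hl, hc, hh, hy =>
      simp only [List.head?_cons, Option.some.injEq] at hh
      subst hh
      rw [List.isChain_cons_cons, List.isChain_cons_cons] at hc
      obtain ⟨h1, h2, h3⟩ := hc
      rcases h1 with ⟨x1, i1, e1, rfl, hx1, hr1⟩ | ⟨x1, i1, e1, _⟩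
      swap
      · simp at e1
      rcases h2 with ⟨x2, i2, e2, _⟩ | ⟨x2, i2, e2, rfl, hx2, hr2⟩
      · simp at e2
      simp only [Sum.inl.injEq, Sum.inr.injEq] at e1 e2
      subst e1 e2
      obtain ⟨n, x, j, hlen, hw, hx0, hxn⟩ := ih (Sum.inl x2 :: l) x2
        (by simp at hl ⊢; omega) h3 rfl (by simpa [List.getLast?_cons_cons] using hy)
      refine ⟨n + 1, fun s => Nat.casesOn s u x, fun s => Nat.casesOn s i1 j, ?_, ?_, rfl, hxn⟩
      · simp at hlen ⊢; omega
      · intro s hs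
        cases s with
        | zero => simpa [hx0] using ⟨⟨hx1, hr1⟩, hx2, hr2⟩
        | succ s => exact hw s (by omega)

theorem distance_lower_bound_in_GR (t k L : ℕ) (ht : 3 ≤ t)
    (e : Fin L → Finset ℕ)
    (he3 : ∀ i, (e i).card = 3)
    (hek : ∀ i, e i ⊆ Finset.Icc 1 k)
    (hdistinct : Function.Injective e)
    (hint : ∀ i j, i ≠ j → (e i ∩ e j).card ≤ 1)
    (hcyc : ¬HasDetourCycle L e t)
    (a : Fin L → ℕ) (ha : ∀ i, a i ∈ e i)
    (R : Finset (Fin L)) (i : Fin L) (hi : i ∉ R)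
    (x' : ℕ) (hx' : x' ∈ e i) (hxa : x' ≠ a i) :
    ((2 * t : ℕ) : ℕ∞) ≤ graphEDist (GRAdj L e a R) (Sum.inl (a i)) (Sum.inl x') := by
  classical
  unfold graphEDist
  apply le_sInf
  rintro _ ⟨p, hp, hh, hl, rfl⟩
  obtain ⟨n0, x0, j0, hlen, hw0, hx00, hx0n⟩ :=
    exists_altWalk L e a R i x' _ p (a i) le_rfl hp hh hl
  rw [Nat.cast_le, hlen]
  by_contra hlt
  have hn0 : n0 < t := by omega
  let P : ℕ → Prop := fun n => ∃ x j, IsAltWalk L e a R n x j ∧ x 0 = a i ∧ x n ∈ e i ∧ x n ≠ a i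
  have hP : ∃ n, P n := ⟨n0, x0, j0, hw0, hx00, hx0n ▸ hx', hx0n ▸ hxa⟩
  have hmin : ∀ m, m < Nat.find hP → ¬ P m := fun m hm => Nat.find_min hP hm
  have hnle : Nat.find hP ≤ n0 :=
    Nat.find_min' hP ⟨x0, j0, hw0, hx00, hx0n ▸ hx', hx0n ▸ hxa⟩
  obtain ⟨x, j, hw, hx0, hxn, hxna⟩ := Nat.find_spec hP
  generalize Nat.find hP = n at *
  -- the walk avoids `i`
  have hji : ∀ s, s < n → j s ≠ i := by
    intro s hs hjs
    obtain ⟨⟨h1, h2⟩, -⟩ := hw s hs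
    rw [hjs] at h1 h2
    exact hmin s hs ⟨x, j, fun r hr => hw r (hr.trans hs), hx0, h1, h2.resolve_left hi⟩
  -- distinct terminals
  have hxinj : ∀ s s', s < s' → s' ≤ n → x s ≠ x s' := by
    intro s s' hss hs' hxx
    refine hmin (n - (s' - s)) (by omega) ⟨fun u => if u ≤ s then x u else x (u + (s' - s)),
      fun u => if u < s then j u else j (u + (s' - s)), ?_, by simp [hx0], ?_⟩
    · intro r hr
      rcases lt_trichotomy r s with h | h | h
      · have h2 : r + 1 ≤ s := h
        simpa only [h, h.le, h2, if_true] using hw r (by omega)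
      · subst h
        have e1 : r + (s' - r) = s' := by omega
        have e2 : r + 1 + (s' - r) = s' + 1 := by omega
        have := hw s' (by omega)
        rw [← hxx] at this
        simpa [e1, e2] using this
      · have e2 : r + 1 + (s' - s) = r + (s' - s) + 1 := by omega
        have h1 : ¬ r < s := by omega
        have h2 : ¬ r ≤ s := by omega
        have h3 : ¬ r + 1 ≤ s := by omega
        simpa only [h1, h2, h3, e2, if_false] using hw (r + (s' - s)) (by omega)
    · have e1 : (if n - (s' - s) ≤ s then x (n - (s' - s)) else x (n - (s' - s) + (s' - s)))
          = x n := by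
        split_ifs with h
        · have e1 : n - (s' - s) = s := by omega
          have e2 : s' = n := by omega
          rw [e1, hxx, e2]
        · congr 1; omega
      simp only [e1]
      exact ⟨hxn, hxna⟩
  have hjinj : ∀ s s', s < s' → s' < n → j s ≠ j s' := by
    intro s s' hss hs' hjj
    refine hmin (n - (s' - s)) (by omega) ⟨fun u => if u ≤ s then x u else x (u + (s' - s)),
      fun u => if u ≤ s then j u else j (u + (s' - s)), ?_, by simp [hx0], ?_⟩
    · intro r hr
      rcases lt_trichotomy r s with h | h | h
      · have h2 : r + 1 ≤ s := h
        simpa only [h.le, h2, if_true] using hw r (by omega)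
      · subst h
        have e2 : r + 1 + (s' - r) = s' + 1 := by omega
        have h1 := (hw r (by omega)).1
        have h2 := (hw s' (by omega)).2
        rw [← hjj] at h2
        simpa [e2] using And.intro h1 h2
      · have e2 : r + 1 + (s' - s) = r + (s' - s) + 1 := by omega
        have h2 : ¬ r ≤ s := by omega
        have h3 : ¬ r + 1 ≤ s := by omega
        simpa only [h2, h3, e2, if_false] using hw (r + (s' - s)) (by omega)
    · have h : ¬ n - (s' - s) ≤ s := by omega
      have e1 : n - (s' - s) + (s' - s) = n := by omega
      simp only [h, if_false, e1]
      exact ⟨hxn, hxna⟩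
  have key : ∀ p q u, p ≠ q → u ∈ e p → u ∈ e q → e p ∩ e q = {u} := by
    intro p q u hpq hp hq
    refine (Finset.eq_of_subset_of_card_le ?_ ?_).symm
    · simp [hp, hq]
    · simpa using hint p q hpq
  have hn0' : n ≠ 0 := by
    rintro rfl
    exact hxna hx0
  have hn1 : n ≠ 1 := by
    rintro rfl
    obtain ⟨⟨h1, -⟩, h2, -⟩ := hw 0 (by omega)
    have h0 : x 0 ∈ e i := hx0 ▸ ha i
    have k1 := key (j 0) i (x 0) (hji 0 (by omega)) h1 h0
    have k2 := key (j 0) i (x 1) (hji 0 (by omega)) h2 hxn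
    rw [k1, Finset.singleton_inj] at k2
    exact hxna (k2 ▸ hx0)
  apply hcyc
  let c : Fin (n + 1) → Fin L := fun s => if s.val = 0 then i else j (s.val - 1)
  have hc : Function.Injective c := by
    intro s s' h
    simp only [c] at h
    have b1 := s.isLt
    have b2 := s'.isLt
    apply Fin.ext
    split_ifs at h with h1 h2 h2
    · omega
    · exact absurd h.symm (hji _ (by omega))
    · exact absurd h (hji _ (by omega))
    · rcases lt_trichotomy s.val s'.val with g | g | g
      · exact absurd h (hjinj _ _ (by omega) (by omega))
      · exact g
      · exact absurd h.symm (hjinj _ _ (by omega) (by omega))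
  have hX : ∀ s s' : Fin (n + 1), s ≠ s' → x s.val ≠ x s'.val := by
    intro s s' h
    have b1 := s.isLt
    have b2 := s'.isLt
    rcases lt_trichotomy s.val s'.val with g | g | g
    · exact hxinj _ _ g (by omega)
    · exact absurd (Fin.ext g) h
    · exact (hxinj _ _ g (by omega)).symm
  have hval : ∀ s : Fin (n + 1), (s + 1).val = if s.val = n then 0 else s.val + 1 := by
    intro s
    rw [Fin.val_add_one]
    simp [Fin.ext_iff]
  have hne : ∀ s : Fin (n + 1), s ≠ s + 1 := by
    intro s h
    have := congrArg Fin.val h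
    rw [hval] at this
    split_ifs at this <;> omega
  have hm1 : ∀ s : Fin (n + 1), x s.val ∈ e (c s) := by
    intro s
    have b1 := s.isLt
    simp only [c]
    split_ifs with h
    · rw [h, hx0]; exact ha i
    · have := (hw (s.val - 1) (by omega)).2.1
      rwa [Nat.sub_add_cancel (by omega)] at this
  have hm2 : ∀ s : Fin (n + 1), x s.val ∈ e (c (s + 1)) := by
    intro s
    have b1 := s.isLt
    simp only [c, hval]
    by_cases h : s.val = n
    · simpa [h] using hxn
    · simpa [h] using (hw s.val (by omega)).1.1
  have hlab : ∀ s : Fin (n + 1), e (c s) ∩ e (c (s + 1)) = {x s.val} := fun s =>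
    key _ _ _ (fun h => hne s (hc h)) (hm1 s) (hm2 s)
  refine ⟨n + 1, by omega, by omega, c, hc, ?_, ?_⟩
  · intro s
    exact (congrArg Finset.card (hlab s)).trans (Finset.card_singleton _)
  · intro s h
    have e2 : s + (2 : ZMod (n + 1)) = (s + (1 : ZMod (n + 1))) + (1 : ZMod (n + 1)) := by ring
    rw [e2] at h
    have := (hlab s).symm.trans (h.trans (hlab (s + (1 : ZMod (n + 1)))))
    rw [Finset.singleton_inj] at this
    exact hX _ _ (hne s) this
end

section
/- Let t ≥ 3, let 𝒮' = {e₁,…,e_ℓ} be distinct 3-element subsets of {1,…,k} pairwise intersecting in at most one element whose detouring graph contains no detouring cycle of length at most t, with distinguished elements a_i ∈ e_i, and let G_R (for R ⊆ {1,…,ℓ}) be the associated graphs. Then for all distinct R₁, R₂ ⊆ {1,…,ℓ} there exist terminals x, x' ∈ {1,…,k} such that one of d_{G_{R₁}}(x,x') and d_{G_{R₂}}(x,x') equals 2 while the other is at least 2t. Consequently, the 2^ℓ graphs G_R are pairwise distinguished, up to a multiplicative factor t or an additive error 2t−2, by their terminal distance profiles. -/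
/-- A detouring walk of `n` steps from `u` to `e i \ {a i}` avoiding the set `e i`. -/
def DWalk {L : ℕ} (e : Fin L → Finset ℕ) (i : Fin L) (x : ℕ) (u n : ℕ)
    (y : ℕ → ℕ) (c : ℕ → Fin L) : Prop :=
  y 0 = u ∧ y n ∈ e i ∧ y n ≠ x ∧
    ∀ j, j < n → c j ≠ i ∧ y j ∈ e (c j) ∧ y (j + 1) ∈ e (c j)

theorem dwalk_of_list {L : ℕ} (e : Fin L → Finset ℕ) (a : Fin L → ℕ) (R : Finset (Fin L))
    (i : Fin L) (hi : i ∉ R) (x' : ℕ) (hx' : x' ∈ e i) (hxa : x' ≠ a i) :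
    ∀ (N : ℕ) (p : List (ℕ ⊕ Fin L)) (u : ℕ), p.length ≤ N → p.IsChain (GRAdj L e a R) →
      p.head? = some (Sum.inl u) → p.getLast? = some (Sum.inl x') →
      ∃ n y c, 2 * n ≤ p.length - 1 ∧ DWalk e i (a i) u n y c := by
  intro N
  induction N using Nat.strong_induction_on with
  | _ N ih =>
  intro p u hN hp hh hl
  match p with
  | [] => simp at hh
  | [z] =>
    simp at hh hl
    subst hh
    simp at hl
    subst hl
    exact ⟨0, fun _ => u, fun _ => i, by simp, rfl, hx', hxa, by simp⟩
  | [z, w] =>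
    simp at hh hl hp
    subst hh hl
    simp [GRAdj] at hp
  | z :: w :: v :: q =>
    simp at hh
    subst hh
    rw [List.isChain_cons_cons, List.isChain_cons_cons] at hp
    obtain ⟨h1, h2, h3⟩ := hp
    obtain ⟨m, rfl, hum, hum'⟩ : ∃ m, w = Sum.inr m ∧ u ∈ e m ∧ (m ∈ R ∨ u ≠ a m) := by
      simpa [GRAdj] using h1
    obtain ⟨r, rfl, hrm, hrm'⟩ : ∃ r, v = Sum.inl r ∧ r ∈ e m ∧ (m ∈ R ∨ r ≠ a m) := by
      simpa [GRAdj] using h2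
    by_cases hmi : m = i
    · subst hmi
      exact ⟨0, fun _ => u, fun _ => m, by simp, rfl, hum, by tauto, by simp⟩
    · simp only [List.length_cons] at hN
      obtain ⟨n, y, c, hn, h0, hy1, hy2, hy3⟩ := ih (N - 2) (by omega) (Sum.inl r :: q) r
        (by simp only [List.length_cons]; omega) h3 (by simp) (by simpa using hl)
      refine ⟨n + 1, fun j => Nat.casesOn j u y, fun j => Nat.casesOn j m c, ?_, rfl, hy1, hy2, ?_⟩
      · simp only [List.length_cons] at hn ⊢; omega
      · intro j hj
        cases j with
        | zero => exact ⟨hmi, hum, by simpa [h0] using hrm⟩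
        | succ j => exact hy3 j (by omega)

theorem no_short_dwalk {L : ℕ} (t : ℕ) (e : Fin L → Finset ℕ)
    (hint : ∀ i j, i ≠ j → (e i ∩ e j).card ≤ 1)
    (hcyc : ¬HasDetourCycle L e t) (i : Fin L) (x : ℕ) (hx : x ∈ e i)
    (n : ℕ) (y : ℕ → ℕ) (c : ℕ → Fin L) (hw : DWalk e i x x n y c) : t ≤ n := by
  classical
  have hex : ∃ n y c, DWalk e i x x n y c := ⟨n, y, c, hw⟩
  suffices h : t ≤ Nat.find hex from h.trans (Nat.find_min' hex ⟨y, c, hw⟩)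
  have hmin : ∀ m, m < Nat.find hex → ¬ ∃ y c, DWalk e i x x m y c :=
    fun m hm => Nat.find_min hex hm
  obtain ⟨y, c, hw⟩ := Nat.find_spec hex
  generalize Nat.find hex = n at *
  clear hex
  obtain ⟨h0, h1, h2, h3⟩ := hw
  by_contra hlt
  push Not at hlt
  have hyinj : ∀ j j', j < j' → j' ≤ n → y j ≠ y j' := by
    intro j j' hj hj' heq
    refine hmin (n - (j' - j)) (by omega)
      ⟨fun m => if m ≤ j then y m else y (m + (j' - j)),
        fun m => if m < j then c m else c (m + (j' - j)), ?_, ?_, ?_, ?_⟩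
    · simp [h0]
    · by_cases hc : n - (j' - j) ≤ j
      · have : n - (j' - j) = j := by omega
        have h4 : j' = n := by omega
        simp only [this, le_refl, if_true]; rw [heq, h4]; exact h1
      · simp only [hc, if_false]; rwa [Nat.sub_add_cancel (by omega)]
    · by_cases hc : n - (j' - j) ≤ j
      · have : n - (j' - j) = j := by omega
        have h4 : j' = n := by omega
        simp only [this, le_refl, if_true]; rw [heq, h4]; exact h2
      · simp only [hc, if_false]; rwa [Nat.sub_add_cancel (by omega)]
    · intro m hm
      rcases lt_trichotomy m j with hmj | hmj | hmj
      · simpa [hmj, hmj.le, Nat.succ_le_of_lt hmj] using h3 m (by omega)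
      · subst hmj
        have := h3 j' (by omega)
        have e1 : m + (j' - m) = j' := by omega
        have e2 : m + 1 + (j' - m) = j' + 1 := by omega
        simpa [e1, e2, heq] using this
      · have := h3 (m + (j' - j)) (by omega)
        have e2 : m + 1 + (j' - j) = m + (j' - j) + 1 := by omega
        have n1 : ¬ m ≤ j := by omega
        have n2 : ¬ m < j := by omega
        have n3 : ¬ m + 1 ≤ j := by omega
        simpa only [n1, n2, n3, if_false, e2] using this
  have hcinj : ∀ j j', j < j' → j' < n → c j ≠ c j' := by
    intro j j' hj hj' heq
    have hc : ¬ n - (j' - j) ≤ j := by omega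
    refine hmin (n - (j' - j)) (by omega)
      ⟨fun m => if m ≤ j then y m else y (m + (j' - j)),
        fun m => if m ≤ j then c m else c (m + (j' - j)), ?_, ?_, ?_, ?_⟩
    · simp [h0]
    · simp only [hc, if_false]; rwa [Nat.sub_add_cancel (by omega)]
    · simp only [hc, if_false]; rwa [Nat.sub_add_cancel (by omega)]
    · intro m hm
      rcases lt_trichotomy m j with hmj | hmj | hmj
      · simpa [hmj, hmj.le, Nat.succ_le_of_lt hmj] using h3 m (by omega)
      · subst hmj
        have h4 := h3 j' (by omega)
        have h5 := h3 m (by omega)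
        have e2 : m + 1 + (j' - m) = j' + 1 := by omega
        have n3 : ¬ m + 1 ≤ m := by omega
        simp only [n3, le_refl, if_true, if_false, e2]
        exact ⟨h5.1, h5.2.1, heq ▸ h4.2.2⟩
      · have := h3 (m + (j' - j)) (by omega)
        have e2 : m + 1 + (j' - j) = m + (j' - j) + 1 := by omega
        have n1 : ¬ m ≤ j := by omega
        have n3 : ¬ m + 1 ≤ j := by omega
        simpa only [n1, n3, if_false, e2] using this
  have hn0 : n ≠ 0 := by
    rintro rfl
    exact h2 h0
  have hinter : ∀ p q z, p ≠ q → z ∈ e p → z ∈ e q → e p ∩ e q = {z} := by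
    intro p q z hpq hp hq
    have hz : z ∈ e p ∩ e q := Finset.mem_inter.2 ⟨hp, hq⟩
    refine (Finset.eq_singleton_iff_unique_mem).2 ⟨hz, fun w hw => ?_⟩
    exact Finset.card_le_one.1 (hint p q hpq) w hw z hz
  have hn1 : n ≠ 1 := by
    rintro rfl
    obtain ⟨g1, g2, g3⟩ := h3 0 (by omega)
    have := hinter (c 0) i x g1 (h0 ▸ g2) hx
    have h5 : y 1 ∈ e (c 0) ∩ e i := Finset.mem_inter.2 ⟨g3, h1⟩
    rw [this] at h5
    exact h2 (by simpa using h5)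
  let C : ℕ → Fin L := fun j => Nat.casesOn j i c
  have hC : ∀ j j', j < j' → j' < n + 1 → C j ≠ C j' := by
    intro j j' hj hj'
    cases j' with
    | zero => omega
    | succ j' =>
      cases j with
      | zero => exact (h3 j' (by omega)).1.symm
      | succ j => exact hcinj j j' (by omega) (by omega)
  have hCinj : Function.Injective (fun q : Fin (n + 1) => C q.val) := by
    intro p q hpq
    by_contra hne
    rcases lt_or_gt_of_ne (fun h => hne (Fin.ext h)) with h | h
    · exact hC _ _ h q.2 hpq
    · exact hC _ _ h p.2 hpq.symm
  have hyi : ∀ p q : Fin (n + 1), y p.val = y q.val → p = q := by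
    intro p q hpq
    by_contra hne
    rcases lt_or_gt_of_ne (fun h => hne (Fin.ext h)) with h | h
    · exact hyinj _ _ h (by omega) hpq
    · exact hyinj _ _ h (by omega) hpq.symm
  have hsucc : ∀ q : Fin (n + 1), q ≠ q + 1 := by
    intro q hq
    have := congrArg Fin.val hq
    rw [Fin.val_add_one] at this
    split_ifs at this with hl
    · subst hl; simp at this; omega
    · omega
  have hmem1 : ∀ q : Fin (n + 1), y q.val ∈ e (C q.val) := by
    rintro ⟨q, hq⟩
    cases q with
    | zero => simpa [C, h0] using hx
    | succ j => exact (h3 j (by omega)).2.2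
  have hmem2 : ∀ q : Fin (n + 1), y q.val ∈ e (C (q + 1).val) := by
    intro q
    rw [Fin.val_add_one]
    split_ifs with hl
    · subst hl; exact h1
    · have : q.val ≠ n := fun h => hl (Fin.ext h)
      exact (h3 q.val (by omega)).2.1
  have hI : ∀ q : Fin (n + 1), e (C q.val) ∩ e (C (q + 1).val) = {y q.val} := fun q =>
    hinter _ _ _ (fun h => hsucc q (hCinj h)) (hmem1 q) (hmem2 q)
  refine hcyc ⟨n + 1, by omega, by omega, fun q : Fin (n + 1) => C q.val, hCinj, ?_, ?_⟩
  · intro q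
    have := hI q
    exact (congrArg Finset.card this).trans (Finset.card_singleton _)
  · intro q hq
    have e2 : q + 2 = (q + 1) + 1 := by ring
    rw [e2] at hq
    have h5 := (hI q).symm.trans (hq.trans (hI ((q + 1 : ZMod (n + 1)))))
    exact hsucc q (hyi _ _ (Finset.singleton_injective h5))

theorem GR_key (t L : ℕ) (e : Fin L → Finset ℕ)
    (hint : ∀ i j, i ≠ j → (e i ∩ e j).card ≤ 1)
    (hcyc : ¬HasDetourCycle L e t)
    (a : Fin L → ℕ) (ha : ∀ i, a i ∈ e i)
    (R₁ R₂ : Finset (Fin L)) (i : Fin L) (h1 : i ∈ R₁) (h2 : i ∉ R₂)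
    (x' : ℕ) (hx' : x' ∈ e i) (hxa : x' ≠ a i) :
    graphEDist (GRAdj L e a R₁) (Sum.inl (a i)) (Sum.inl x') = 2 ∧
      ((2 * t : ℕ) : ℕ∞) ≤ graphEDist (GRAdj L e a R₂) (Sum.inl (a i)) (Sum.inl x') := by
  refine ⟨le_antisymm ?_ ?_, ?_⟩
  · refine sInf_le ⟨[Sum.inl (a i), Sum.inr i, Sum.inl x'], ?_, rfl, rfl, by simp⟩
    show List.IsChain _ _
    simp [GRAdj, h1, hx', ha i]
  · refine le_sInf ?_
    rintro n ⟨p, hp, hh, hl, rfl⟩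
    replace hp : p.IsChain _ := hp
    match p with
    | [] => simp at hh
    | [z] =>
      simp at hh hl
      subst hh
      simp at hl
      exact absurd hl.symm hxa
    | [z, w] =>
      simp at hh hl hp
      subst hh hl
      simp [GRAdj] at hp
    | z :: w :: v :: q =>
      simp only [List.length_cons]
      exact_mod_cast (by omega : 2 ≤ q.length + 1 + 1 + 1 - 1)
  · refine le_sInf ?_
    rintro n ⟨p, hp, hh, hl, rfl⟩
    obtain ⟨n, y, c, hn, hw⟩ := dwalk_of_list e a R₂ i h2 x' hx' hxa p.length p (a i) le_rfl hp hh hl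
    have := no_short_dwalk t e hint hcyc i (a i) (ha i) n y c hw
    exact_mod_cast (by omega : 2 * t ≤ p.length - 1)

/-- Let `t ≥ 3` and let `e 1, …, e L` be distinct 3-element subsets of `{1,…,k}`
pairwise intersecting in at most one element, whose detouring graph contains no
detouring cycle of length at most `t`, with distinguished elements `a i ∈ e i`.  Then
for all distinct `R₁, R₂` there are terminals `x, x' ∈ {1,…,k}` such that one of the
distances `d_{G_{R₁}}(x,x')`, `d_{G_{R₂}}(x,x')` equals `2` while the other is at
least `2t`. -/
theorem GR_graphs_pairwise_distinguished (t k L : ℕ) (ht : 3 ≤ t)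
    (e : Fin L → Finset ℕ)
    (he3 : ∀ i, (e i).card = 3)
    (hek : ∀ i, e i ⊆ Finset.Icc 1 k)
    (hdistinct : Function.Injective e)
    (hint : ∀ i j, i ≠ j → (e i ∩ e j).card ≤ 1)
    (hcyc : ¬HasDetourCycle L e t)
    (a : Fin L → ℕ) (ha : ∀ i, a i ∈ e i)
    (R₁ R₂ : Finset (Fin L)) (hne : R₁ ≠ R₂) :
    ∃ x x' : ℕ, x ∈ Finset.Icc 1 k ∧ x' ∈ Finset.Icc 1 k ∧
      ((graphEDist (GRAdj L e a R₁) (Sum.inl x) (Sum.inl x') = 2 ∧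
        ((2 * t : ℕ) : ℕ∞) ≤ graphEDist (GRAdj L e a R₂) (Sum.inl x) (Sum.inl x')) ∨
       (graphEDist (GRAdj L e a R₂) (Sum.inl x) (Sum.inl x') = 2 ∧
        ((2 * t : ℕ) : ℕ∞) ≤ graphEDist (GRAdj L e a R₁) (Sum.inl x) (Sum.inl x'))) := by

  have hx : ∀ i, ∃ x' ∈ e i, x' ≠ a i := fun i =>
    Finset.exists_mem_ne (by rw [he3 i]; norm_num) (a i)
  obtain ⟨i, hi⟩ : ∃ i, ¬ (i ∈ R₁ ↔ i ∈ R₂) := by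
    by_contra h
    push Not at h
    exact hne (Finset.ext h)
  obtain ⟨x', hx', hxa⟩ := hx i
  refine ⟨a i, x', hek i (ha i), hek i hx', ?_⟩
  by_cases h1 : i ∈ R₁
  · exact Or.inl (GR_key t L e hint hcyc a ha R₁ R₂ i h1 (by tauto) x' hx' hxa)
  · exact Or.inr (GR_key t L e hint hcyc a ha R₂ R₁ i (by tauto) h1 x' hx' hxa)
end
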